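/- arXiv:2406.17943 — 2 statements merged into one kernel-verified Lean document; each statement's English description precedes it below -/
import Mathlib

section
/- Any artinian Gorenstein algebra over an algebraically closed field of characteristic zero with h-vector (1, 5, 6, 6, 5, 1) has the weak Lefschetz property. -/
open MvPolynomial

noncomputable section

variable {K : Type*} [Field K] {n : ℕ}

/-- The degree `i` graded piece of the standard graded algebra `R/I`,
where `R = K[x_1,…,x_n]`. -/
def piece (I : Ideal (MvPolynomial (Fin n) K)) (i : ℕ) :
    Submodule K (MvPolynomial (Fin n) K ⧸ I) :=
  (homogeneousSubmodule (Fin n) K i).map (Ideal.Quotient.mkₐ K I).toLinearMap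

/-- The Hilbert function of the standard graded algebra `R/I`. -/
def hf (I : Ideal (MvPolynomial (Fin n) K)) (i : ℕ) : ℕ :=
  Module.finrank K (piece I i)

/-- `I` is a homogeneous ideal. -/
def IsHomogIdeal (I : Ideal (MvPolynomial (Fin n) K)) : Prop :=
  ∀ p ∈ I, ∀ i : ℕ, homogeneousComponent i p ∈ I

/-- The socle of `R/I`: the annihilator of the irrelevant maximal ideal. -/
def socle (I : Ideal (MvPolynomial (Fin n) K)) :
    Submodule K (MvPolynomial (Fin n) K ⧸ I) :=
  ⨅ j : Fin n, LinearMap.ker (LinearMap.mulLeft K (Ideal.Quotient.mk I (X j)))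

/-- `R/I` is a standard graded artinian Gorenstein algebra of socle degree `d`:
`I` is homogeneous, the Hilbert function vanishes above degree `d`, is symmetric,
and the socle is one-dimensional, concentrated in degree `d`. -/
def IsArtinianGorenstein (I : Ideal (MvPolynomial (Fin n) K)) (d : ℕ) : Prop :=
  IsHomogIdeal I ∧ hf I d = 1 ∧ (∀ i : ℕ, d < i → hf I i = 0) ∧
    (∀ i : ℕ, i ≤ d → hf I i = hf I (d - i)) ∧
    Module.finrank K (socle I) = 1 ∧ socle I ≤ piece I d

/-- The weak Lefschetz property for `R/I`: there is a linear form `ℓ` such that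
multiplication `×ℓ : [A]_i → [A]_{i+1}` has maximal rank (is injective or
surjective) for every `i`. -/
def WLP (I : Ideal (MvPolynomial (Fin n) K)) : Prop :=
  ∃ ℓ : MvPolynomial (Fin n) K, ℓ.IsHomogeneous 1 ∧ ∀ i : ℕ,
    (∀ a ∈ piece I i, Ideal.Quotient.mk I ℓ * a = 0 → a = 0) ∨
    (∀ b ∈ piece I (i + 1), ∃ a ∈ piece I i, Ideal.Quotient.mk I ℓ * a = b)

/-- The strong Lefschetz property for `R/I`: there is a linear form `ℓ` such that
`×ℓ^k : [A]_i → [A]_{i+k}` has maximal rank for all `i ≥ 0`, `k ≥ 1`. -/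
def SLP (I : Ideal (MvPolynomial (Fin n) K)) : Prop :=
  ∃ ℓ : MvPolynomial (Fin n) K, ℓ.IsHomogeneous 1 ∧ ∀ i k : ℕ, 1 ≤ k →
    ((∀ a ∈ piece I i, Ideal.Quotient.mk I ℓ ^ k * a = 0 → a = 0) ∨
     (∀ b ∈ piece I (i + k), ∃ a ∈ piece I i, Ideal.Quotient.mk I ℓ ^ k * a = b))

/-- The action of `p ∈ R = K[x_1,…,x_n]` on `S = K[X_1,…,X_n]` by differentiation,
`x_i` acting as `∂/∂X_i`. -/
def diffOp (p : MvPolynomial (Fin n) K) :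
    Module.End K (MvPolynomial (Fin n) K) :=
  ∑ m ∈ p.support, MvPolynomial.coeff m p •
    (List.ofFn fun j : Fin n =>
      ((pderiv j).toLinearMap : Module.End K (MvPolynomial (Fin n) K)) ^ (m j)).prod

/-- The degree-`d` graded piece of the inverse system `I^⊥ = {F : g ∘ F = 0 ∀ g ∈ I}`. -/
def invSys (I : Ideal (MvPolynomial (Fin n) K)) (d : ℕ) :
    Submodule K (MvPolynomial (Fin n) K) :=
  homogeneousSubmodule (Fin n) K d ⊓ ⨅ g ∈ I, LinearMap.ker (diffOp g)

end

section helpers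

/-- The final algebraic step of the chain argument. -/
theorem chain_dep {A : Type*} [CommRing A] {l m a0 a1 a2 c0 c1 c2 : A} (h0 : l * a0 = 0)
    (e0 : l * a1 + m * a0 = 0) (e1 : l * a2 + m * a1 = 0)
    (hg : c0 * (m * a0) + c1 * (m * a1) + c2 * (m * a2) = 0) :
    c2 * (m * (m * (m * a0))) = 0 ∧ (c2 = 0 → c1 * (m * (m * (m * a0))) = 0) ∧
      (c2 = 0 → c1 = 0 → c0 * (m * (m * (m * a0))) = 0) := by
  have f1 : l * (m * a0) = 0 := by linear_combination m * h0
  have f2 : l * (l * (m * a1)) = 0 := by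
    linear_combination l * m * e0 - m * f1
  have f3 : m * (m * (m * a0)) = l * (l * (m * a2)) := by
    linear_combination m * m * e0 - l * m * e1
  refine ⟨?_, fun g2 => ?_, fun g2 g1 => ?_⟩
  · rw [f3]
    linear_combination l * l * hg - c0 * l * f1 - c1 * f2
  · subst g2
    linear_combination c1 * m * m * e0 - l * m * hg + c0 * m * m * h0
  · subst g2 g1
    linear_combination m * m * hg

theorem chain_indep {A : Type*} [CommRing A] {l m a0 a1 a2 a3 c0 c1 c2 c3 : A} (h0 : l * a0 = 0)
    (e0 : l * a1 + m * a0 = 0) (e1 : l * a2 + m * a1 = 0) (e2 : l * a3 + m * a2 = 0)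
    (hg : c0 * a0 + c1 * a1 + c2 * a2 + c3 * a3 = 0) :
    c1 * (m * a0) + c2 * (m * a1) + c3 * (m * a2) = 0 := by
  linear_combination c1 * e0 + c2 * e1 + c3 * e2 - l * hg + c0 * h0

variable {K : Type*} [Field K] {n : ℕ}

theorem smul_q (I : Ideal (MvPolynomial (Fin n) K)) (c : K) (a : MvPolynomial (Fin n) K ⧸ I) :
    c • a = Ideal.Quotient.mk I (C c) * a :=
  Algebra.smul_def c a

theorem smul_q_zero {I : Ideal (MvPolynomial (Fin n) K)} {c : K} {a : MvPolynomial (Fin n) K ⧸ I}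
    (h : Ideal.Quotient.mk I (C c) * a = 0) (hc : c ≠ 0) : a = 0 := by
  rw [← smul_q] at h
  exact (smul_eq_zero.1 h).resolve_left hc

theorem piece_mul_mem {I : Ideal (MvPolynomial (Fin n) K)} {i j : ℕ}
    {a b : MvPolynomial (Fin n) K ⧸ I} (ha : a ∈ piece I i) (hb : b ∈ piece I j) :
    a * b ∈ piece I (i + j) := by
  obtain ⟨p, hp, rfl⟩ := ha
  obtain ⟨q, hq, rfl⟩ := hb
  refine ⟨p * q, ?_, by simp⟩
  exact (mem_homogeneousSubmodule _ _).2 (IsHomogeneous.mul hp hq)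

theorem piece_one_mem (I : Ideal (MvPolynomial (Fin n) K)) : 1 ∈ piece I 0 :=
  ⟨1, (mem_homogeneousSubmodule _ _).2 (isHomogeneous_one _ _), by simp⟩

theorem piece_mk_mem (I : Ideal (MvPolynomial (Fin n) K)) {p : MvPolynomial (Fin n) K} {i : ℕ}
    (hp : p.IsHomogeneous i) : Ideal.Quotient.mk I p ∈ piece I i :=
  ⟨p, (mem_homogeneousSubmodule _ _).2 hp, by simp⟩

theorem piece_X_mem (I : Ideal (MvPolynomial (Fin n) K)) (k : Fin n) :
    Ideal.Quotient.mk I (X k) ∈ piece I 1 :=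
  piece_mk_mem I (isHomogeneous_X _ _)

theorem piece_disj {I : Ideal (MvPolynomial (Fin n) K)} (hI : IsHomogIdeal I) {i j : ℕ}
    (hij : i ≠ j) {a : MvPolynomial (Fin n) K ⧸ I} (hi : a ∈ piece I i) (hj : a ∈ piece I j) :
    a = 0 := by
  obtain ⟨p, hp, rfl⟩ := hi
  obtain ⟨q, hq, hqp⟩ := hj
  have h1 : p - q ∈ I := by
    rw [← Ideal.Quotient.eq]
    exact hqp.symm
  have h2 := hI _ h1 i
  rw [map_sub, homogeneousComponent_of_mem hp, homogeneousComponent_of_mem hq] at h2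
  simp only [if_true, if_neg hij, sub_zero] at h2
  simpa using Ideal.Quotient.eq_zero_iff_mem.2 h2

theorem soc_zero {I : Ideal (MvPolynomial (Fin n) K)} {d : ℕ} (hA : IsArtinianGorenstein I d)
    {i : ℕ} (hi : i < d) {a : MvPolynomial (Fin n) K ⧸ I} (ha : a ∈ piece I i)
    (h : ∀ k, Ideal.Quotient.mk I (X k) * a = 0) : a = 0 := by
  refine piece_disj hA.1 hi.ne ha (hA.2.2.2.2.2 ?_)
  simp only [socle, Submodule.mem_iInf]
  intro k
  simpa using h k

theorem pair_zero {I : Ideal (MvPolynomial (Fin n) K)} {d : ℕ} (hA : IsArtinianGorenstein I d)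
    (j : ℕ) : ∀ (i : ℕ), i + j ≤ d → ∀ {a : MvPolynomial (Fin n) K ⧸ I}, a ∈ piece I i →
    (∀ b ∈ piece I j, a * b = 0) → a = 0 := by
  induction j with
  | zero =>
    intro i _ a _ h
    simpa using h 1 (piece_one_mem I)
  | succ j ih =>
    intro i hi a ha h
    refine soc_zero hA (i := i) (by omega) ha fun k => ?_
    refine ih (1 + i) (by omega) (piece_mul_mem (piece_X_mem I k) ha) fun b hb => ?_
    have := h (Ideal.Quotient.mk I (X k) * b)
      (by rw [add_comm j 1]; exact piece_mul_mem (piece_X_mem I k) hb)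
    rw [← this]; ring

instance piece_finite (I : Ideal (MvPolynomial (Fin n) K)) (i : ℕ) :
    Module.Finite K (piece I i) := by
  have : Module.Finite K (homogeneousSubmodule (Fin n) K i) :=
    Module.Finite.iff_fg.2 (homogeneousSubmodule_fg (Fin n) K i)
  unfold piece
  infer_instance

/-- A functional detecting the top degree piece. -/
theorem exists_top_functional {I : Ideal (MvPolynomial (Fin n) K)} {d : ℕ} (h : hf I d = 1) :
    ∃ φ : (MvPolynomial (Fin n) K ⧸ I) →ₗ[K] K, ∀ a ∈ piece I d, φ a = 0 → a = 0 := by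
  have h' : Module.finrank K (piece I d) = Module.finrank K K := by
    rw [Module.finrank_self]; exact h
  let e := LinearEquiv.ofFinrankEq _ _ h'
  obtain ⟨φ, hφ⟩ := LinearMap.exists_extend e.toLinearMap
  refine ⟨φ, fun a ha h0 => ?_⟩
  have h1 := LinearMap.congr_fun hφ ⟨a, ha⟩
  simp only [LinearMap.comp_apply, Submodule.subtype_apply, h0] at h1
  have : (⟨a, ha⟩ : piece I d) = 0 := e.injective (h1.symm.trans (map_zero e.toLinearMap).symm)
  simpa using congrArg Subtype.val this

/-- The pairing, as a map to the dual space. -/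
noncomputable def pairMap (I : Ideal (MvPolynomial (Fin n) K)) (φ : (MvPolynomial (Fin n) K ⧸ I) →ₗ[K] K)
    (i j : ℕ) : piece I i →ₗ[K] Module.Dual K (piece I j) :=
  ((LinearMap.mul K (MvPolynomial (Fin n) K ⧸ I)).compr₂ φ).domRestrict₁₂ (piece I i) (piece I j)

theorem pairMap_apply (I : Ideal (MvPolynomial (Fin n) K))
    (φ : (MvPolynomial (Fin n) K ⧸ I) →ₗ[K] K) (i j : ℕ) (a : piece I i) (b : piece I j) :
    pairMap I φ i j a b = φ (a.1 * b.1) := rfl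

theorem pairMap_inj {I : Ideal (MvPolynomial (Fin n) K)} {d : ℕ} (hA : IsArtinianGorenstein I d)
    {φ : (MvPolynomial (Fin n) K ⧸ I) →ₗ[K] K} (hφ : ∀ a ∈ piece I d, φ a = 0 → a = 0)
    {i j : ℕ} (hij : i + j = d) : Function.Injective (pairMap I φ i j) := by
  rw [injective_iff_map_eq_zero]
  intro a h
  apply Subtype.ext
  refine pair_zero hA j i hij.le a.2 fun b hb => ?_
  refine hφ _ (by rw [← hij]; exact piece_mul_mem a.2 hb) ?_
  exact LinearMap.congr_fun h ⟨b, hb⟩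

/-- If `ℓ` is injective from degree `p` to degree `p+1`, it is surjective from degree
`d-p-1` to degree `d-p`. -/
theorem surj_of_inj {I : Ideal (MvPolynomial (Fin n) K)} {d : ℕ} (hA : IsArtinianGorenstein I d)
    {p i : ℕ} (hp : p + (i + 1) = d) {l : MvPolynomial (Fin n) K ⧸ I} (hl : l ∈ piece I 1)
    (hinj : ∀ a ∈ piece I p, l * a = 0 → a = 0) :
    ∀ b ∈ piece I (i + 1), ∃ a ∈ piece I i, l * a = b := by
  obtain ⟨φ, hφ⟩ := exists_top_functional hA.2.1
  have hle : (piece I i).map (LinearMap.mulLeft K l) ≤ piece I (i + 1) := by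
    rintro _ ⟨a, ha, rfl⟩
    rw [add_comm]
    exact piece_mul_mem hl ha
  by_contra hcon
  push Not at hcon
  obtain ⟨b, hb, hne⟩ := hcon
  let N : Submodule K (piece I (i + 1)) :=
    ((piece I i).map (LinearMap.mulLeft K l)).comap (piece I (i + 1)).subtype
  have hbN : (⟨b, hb⟩ : piece I (i + 1)) ∉ N := by
    rintro ⟨a, ha, hab⟩
    exact hne a ha hab
  obtain ⟨f, hf1, hf2⟩ := Submodule.exists_le_ker_of_notMem hbN
  have hfr : Module.finrank K (piece I p) = Module.finrank K (Module.Dual K (piece I (i + 1))) := by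
    rw [Subspace.dual_finrank_eq]
    have := hA.2.2.2.1 p (by omega)
    rw [show d - p = i + 1 by omega] at this
    exact this
  have hsurj := (LinearMap.injective_iff_surjective_of_finrank_eq_finrank hfr).1
    (pairMap_inj hA hφ hp)
  obtain ⟨x, rfl⟩ := hsurj f
  have hx : x.1 = 0 := by
    refine hinj _ x.2 ?_
    refine pair_zero hA i (1 + p) (by omega) (piece_mul_mem hl x.2) fun a ha => ?_
    have hla : l * a ∈ piece I (i + 1) := hle ⟨a, ha, rfl⟩
    have h1 : pairMap I φ p (i + 1) x ⟨l * a, hla⟩ = 0 :=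
      hf2 (show (⟨l * a, hla⟩ : piece I (i + 1)) ∈ N from ⟨a, ha, rfl⟩)
    rw [pairMap_apply] at h1
    have h2 := hφ _ (by rw [← hp]; exact piece_mul_mem x.2 hla) h1
    rw [← h2]; ring
  apply hf1
  rw [pairMap_apply, hx, zero_mul, map_zero]

/-- Key lemma: a chain `a` in degree 2 with `ℓ a₀ = 0`, `ℓ aₖ₊₁ = - m aₖ` satisfies
`m³ a₀ = 0`. -/
theorem key_chain {I : Ideal (MvPolynomial (Fin n) K)} (hA : IsArtinianGorenstein I 5)
    (h2 : hf I 2 = 6) {l m : MvPolynomial (Fin n) K ⧸ I} (hm : m ∈ piece I 1)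
    (a : ℕ → MvPolynomial (Fin n) K ⧸ I) (ha : ∀ k, a k ∈ piece I 2)
    (h0 : l * a 0 = 0) (hs : ∀ k, l * a (k + 1) + m * a k = 0) : m * (m * (m * a 0)) = 0 := by
  have hs' : ∀ k, m * a k = - (l * a (k + 1)) := fun k => by linear_combination hs k
  by_cases ha0 : a 0 = 0
  · simp [ha0]
  have iso : ∀ i j, l * (a i * a j) = 0 := by
    intro i
    induction i with
    | zero => intro j; rw [← mul_assoc, h0, zero_mul]
    | succ i ih =>
      intro j
      have := ih (j + 1)
      linear_combination a j * hs i - a i * hs j + this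
  obtain ⟨φ, hφ⟩ := exists_top_functional hA.2.1
  let w : Fin 3 → MvPolynomial (Fin n) K ⧸ I := fun k => m * a k
  have hw : ∀ k, w k ∈ piece I 3 := fun k => piece_mul_mem hm (ha _)
  have hdep : ¬ LinearIndependent K w := by
    intro hli
    let w' : Fin 3 → piece I 3 := fun k => ⟨w k, hw k⟩
    have hw' : LinearIndependent K w' := LinearIndependent.of_comp (piece I 3).subtype hli
    let a' : Fin 4 → piece I 2 := fun k => ⟨a k, ha k⟩
    have hli3 := Fintype.linearIndependent_iff.1 hli
    have ha' : LinearIndependent K a' := by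
      rw [Fintype.linearIndependent_iff]
      intro g hg
      have hg1 : ∑ k : Fin 4, g k • a k = 0 := by
        have := congrArg Subtype.val hg
        simpa [a'] using this
      have hz := hli3 (fun k => g k.succ) (by
        simp only [Fin.sum_univ_four, smul_q] at hg1
        simp only [Fin.sum_univ_three, smul_q]
        exact chain_indep h0 (hs 0) (hs 1) (hs 2) hg1)
      have hg0 : g 0 • a 0 = 0 := by
        rw [Fin.sum_univ_succ] at hg1
        simp only [hz, zero_smul, Finset.sum_const_zero, add_zero] at hg1
        simpa using hg1
      intro k
      refine Fin.cases ?_ (fun k => hz k) k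
      exact (smul_eq_zero.1 hg0).resolve_right ha0
    let U : Submodule K (piece I 2) := Submodule.span K (Set.range a')
    have hU : Module.finrank K U = 4 := by
      simpa using finrank_span_eq_card ha'
    have hT : LinearIndependent K (fun k => pairMap I φ 3 2 (w' k)) :=
      hw'.map' _ (LinearMap.ker_eq_bot.2 (pairMap_inj hA hφ (by norm_num)))
    have hTle : Submodule.span K (Set.range fun k => pairMap I φ 3 2 (w' k)) ≤
        U.dualAnnihilator := by
      rw [Submodule.span_le]
      rintro _ ⟨k, rfl⟩
      rw [SetLike.mem_coe, Submodule.mem_dualAnnihilator]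
      intro u hu
      have hle : U ≤ LinearMap.ker (pairMap I φ 3 2 (w' k)) := by
        rw [Submodule.span_le]
        rintro _ ⟨j, rfl⟩
        rw [SetLike.mem_coe, LinearMap.mem_ker, pairMap_apply]
        have : (w' k).1 * (a' j).1 = 0 := by
          change m * a k * a j = 0
          have := iso (k + 1) j
          linear_combination a j * hs k - this
        rw [this, map_zero]
      exact hle hu
    have hf1 := Submodule.finrank_mono hTle
    rw [finrank_span_eq_card hT] at hf1
    have hf2 := Subspace.finrank_add_finrank_dualAnnihilator_eq U
    rw [hU, show Module.finrank K (piece I 2) = 6 from h2] at hf2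
    simp at hf1
    omega
  rw [Fintype.linearIndependent_iff] at hdep
  push Not at hdep
  obtain ⟨g, hg, k, hk⟩ := hdep
  simp only [Fin.sum_univ_three, smul_q] at hg
  obtain ⟨r2, r1, r0⟩ := chain_dep (a2 := a 2) h0 (hs 0) (hs 1) hg
  by_cases g2 : g 2 = 0
  · have g2' : Ideal.Quotient.mk I (C (g 2)) = 0 := by rw [g2, C_0, map_zero]
    by_cases g1 : g 1 = 0
    · have g1' : Ideal.Quotient.mk I (C (g 1)) = 0 := by rw [g1, C_0, map_zero]
      refine smul_q_zero (r0 g2' g1') ?_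
      intro g0
      fin_cases k
      · exact hk g0
      · exact hk g1
      · exact hk g2
    · exact smul_q_zero (r1 g2') g1
  · exact smul_q_zero r2 g2

end helpers

section main

variable {K : Type*} [Field K] {n : ℕ}

/-- The class in `R/I` of the linear form with coefficient vector `x`. -/
noncomputable def linClass (I : Ideal (MvPolynomial (Fin n) K)) (x : Fin n → K) : MvPolynomial (Fin n) K ⧸ I :=
  ∑ k, x k • Ideal.Quotient.mk I (X k)

theorem linClass_mem (I : Ideal (MvPolynomial (Fin n) K)) (x : Fin n → K) :
    linClass I x ∈ piece I 1 :=
  Submodule.sum_mem _ fun k _ => Submodule.smul_mem _ _ (piece_X_mem I k)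

theorem linClass_add (I : Ideal (MvPolynomial (Fin n) K)) (x y : Fin n → K) :
    linClass I (x + y) = linClass I x + linClass I y := by
  simp [linClass, add_smul, Finset.sum_add_distrib]

theorem linClass_single (I : Ideal (MvPolynomial (Fin n) K)) (k : Fin n) :
    linClass I (Pi.single k 1) = Ideal.Quotient.mk I (X k) := by
  simp [linClass, Pi.single_apply]

theorem linClass_eq_mk (I : Ideal (MvPolynomial (Fin n) K)) (x : Fin n → K) :
    ∃ p : MvPolynomial (Fin n) K, p.IsHomogeneous 1 ∧ Ideal.Quotient.mk I p = linClass I x := by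
  obtain ⟨p, hp, h⟩ := linClass_mem I x
  exact ⟨p, hp, h⟩

/-- A degree two element annihilated by all cubes of linear forms vanishes. -/
theorem zero_of_cubes [CharZero K] {I : Ideal (MvPolynomial (Fin n) K)}
    (hA : IsArtinianGorenstein I 5) {a : MvPolynomial (Fin n) K ⧸ I} (ha : a ∈ piece I 2)
    (h : ∀ y, linClass I y * (linClass I y * (linClass I y * a)) = 0) : a = 0 := by
  have pol : ∀ x y z, linClass I x * (linClass I y * (linClass I z * a)) = 0 := by
    intro x y z
    have e1 := h (x + y + z)
    have e2 := h (x + y)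
    have e3 := h (x + z)
    have e4 := h (y + z)
    have e5 := h x
    have e6 := h y
    have e7 := h z
    simp only [linClass_add] at e1 e2 e3 e4
    refine smul_q_zero (c := 6) ?_ (by norm_num)
    rw [map_ofNat, map_ofNat]
    linear_combination e1 - e2 - e3 - e4 + e5 + e6 + e7
  refine soc_zero hA (by norm_num) ha fun i => ?_
  have hi := piece_mul_mem (piece_X_mem I i) ha
  refine soc_zero hA (by norm_num) hi fun j => ?_
  have hj := piece_mul_mem (piece_X_mem I j) hi
  refine soc_zero hA (by norm_num) hj fun k => ?_
  simpa only [linClass_single] using pol (Pi.single k 1) (Pi.single j 1) (Pi.single i 1)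

/-- Some linear form acts injectively from degree 2 to degree 3. -/
theorem exists_inj [CharZero K] {I : Ideal (MvPolynomial (Fin n) K)}
    (hA : IsArtinianGorenstein I 5) (h2 : hf I 2 = 6) :
    ∃ x : Fin n → K, ∀ a ∈ piece I 2, linClass I x * a = 0 → a = 0 := by
  obtain ⟨φ, hφ⟩ := exists_top_functional hA.2.1
  let e : Module.Basis (Fin 6) K (piece I 2) := Module.finBasisOfFinrankEq K (piece I 2) h2
  -- an element of degree 3 orthogonal to the basis vanishes
  have horth : ∀ b ∈ piece I 3, (∀ i, φ (b * (e i).1) = 0) → b = 0 := by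
    intro b hb h
    have : pairMap I φ 3 2 ⟨b, hb⟩ = 0 := e.ext fun i => by
      rw [pairMap_apply]; simpa using h i
    have h1 := pairMap_inj hA hφ (i := 3) (j := 2) (by norm_num) (this.trans (map_zero _).symm)
    simpa using congrArg Subtype.val h1
  let M : Matrix (Fin 6) (Fin 6) (MvPolynomial (Fin n) K) := fun i j =>
    ∑ k, C (φ (Ideal.Quotient.mk I (X k) * (e j).1 * (e i).1)) * X k
  have hlin : ∀ (x : Fin n → K) (i j : Fin 6),
      φ (linClass I x * (e j).1 * (e i).1) =
        ∑ k, φ (Ideal.Quotient.mk I (X k) * (e j).1 * (e i).1) * x k := by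
    intro x i j
    simp only [linClass, Finset.sum_mul, map_sum, smul_mul_assoc, map_smul, smul_eq_mul]
    exact Finset.sum_congr rfl fun k _ => mul_comm _ _
  by_cases hdet : M.det = 0
  · exfalso
    obtain ⟨v, hv, hMv⟩ := Matrix.exists_mulVec_eq_zero_iff.2 hdet
    obtain ⟨j0, hj0⟩ := Function.ne_iff.1 hv
    obtain ⟨x, hx⟩ : ∃ x, eval x (v j0) ≠ 0 := by
      by_contra hcon
      push Not at hcon
      exact hj0 (MvPolynomial.funext fun x => by simpa using hcon x)
    let a0 : piece I 2 := ∑ j, eval x (v j) • e j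
    have ha0 : a0 ≠ 0 := by
      intro h
      exact hx (Fintype.linearIndependent_iff.1 e.linearIndependent _ h j0)
    apply ha0
    apply Subtype.ext
    refine zero_of_cubes hA a0.2 fun y => ?_
    let θ : MvPolynomial (Fin n) K →ₐ[K] Polynomial K :=
      aeval fun k => Polynomial.C (x k) + Polynomial.C (y k) * Polynomial.X
    have hθM : ∀ i j, θ (M i j) = Polynomial.C (φ (linClass I x * (e j).1 * (e i).1)) +
        Polynomial.C (φ (linClass I y * (e j).1 * (e i).1)) * Polynomial.X := by
      intro i j
      rw [hlin, hlin]
      simp only [M, θ, map_sum, map_mul, aeval_X, algHom_C, Polynomial.algebraMap_eq,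
        Finset.sum_mul, ← Finset.sum_add_distrib]
      exact Finset.sum_congr rfl fun k _ => by ring
    have hθ0 : ∀ p, (θ p).coeff 0 = eval x p := by
      intro p
      rw [Polynomial.coeff_zero_eq_eval_zero]
      have : ((Polynomial.evalRingHom (0 : K)).comp θ.toRingHom) = eval x := by
        apply MvPolynomial.ringHom_ext
        · intro r; simp [θ]
        · intro k; simp [θ]
      exact RingHom.congr_fun this p
    have hsum : ∀ i, ∑ j, θ (M i j) * θ (v j) = 0 := by
      intro i
      have := congrArg θ (congrFun hMv i)
      simpa [Matrix.mulVec, dotProduct] using this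
    let a : ℕ → piece I 2 := fun k => ∑ j, (θ (v j)).coeff k • e j
    have haa : a 0 = a0 := by simp only [a, a0, hθ0]
    have hexp : ∀ (z : Fin n → K) (k : ℕ) (i : Fin 6), φ (linClass I z * (a k).1 * (e i).1) =
        ∑ j, φ (linClass I z * (e j).1 * (e i).1) * (θ (v j)).coeff k := by
      intro z k i
      simp only [a, Submodule.coe_sum, Submodule.coe_smul, Finset.mul_sum, Finset.sum_mul,
        map_sum, mul_smul_comm, smul_mul_assoc, map_smul, smul_eq_mul]
      exact Finset.sum_congr rfl fun k _ => mul_comm _ _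
    have key := key_chain hA h2 (l := linClass I x) (linClass_mem I y) (fun k => (a k).1)
      (fun k => (a k).2) ?_ ?_
    · simpa only [haa] using key
    · refine horth _ (piece_mul_mem (linClass_mem I x) (a 0).2) fun i => ?_
      rw [hexp]
      have := congrArg (fun p => Polynomial.coeff p 0) (hsum i)
      simpa [hθM, Polynomial.finsetSum_coeff, Polynomial.mul_coeff_zero] using this
    · intro k
      refine horth _ (Submodule.add_mem _ (piece_mul_mem (linClass_mem I x) (a (k + 1)).2)
        (piece_mul_mem (linClass_mem I y) (a k).2)) fun i => ?_
      rw [add_mul, map_add, hexp, hexp, ← Finset.sum_add_distrib]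
      have := congrArg (fun p => Polynomial.coeff p (k + 1)) (hsum i)
      simp only [hθM, Polynomial.finsetSum_coeff, add_mul, mul_assoc, Polynomial.coeff_add,
        Polynomial.coeff_C_mul, Polynomial.coeff_X_mul, Polynomial.coeff_zero] at this
      simpa only [mul_assoc] using this
  · obtain ⟨x, hx⟩ : ∃ x, eval x M.det ≠ 0 := by
      by_contra hcon
      push Not at hcon
      exact hdet (MvPolynomial.funext fun x => by simpa using hcon x)
    refine ⟨x, fun a ha h => ?_⟩
    rw [RingHom.map_det] at hx
    let c : Fin 6 → K := fun j => e.repr ⟨a, ha⟩ j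
    have hac : a = ∑ j, c j • (e j).1 := by
      have := congrArg Subtype.val (e.sum_repr ⟨a, ha⟩)
      rw [Submodule.coe_sum] at this
      exact this.symm
    have hc : c = 0 := by
      refine Matrix.eq_zero_of_mulVec_eq_zero hx ?_
      funext i
      have h1 : φ (linClass I x * a * (e i).1) = 0 := by rw [h, zero_mul, map_zero]
      rw [hac] at h1
      simp only [Finset.mul_sum, Finset.sum_mul, map_sum, mul_smul_comm, smul_mul_assoc,
        map_smul, smul_eq_mul, hlin] at h1
      have hM : ∀ j, (eval x).mapMatrix M i j =
          ∑ k, φ (Ideal.Quotient.mk I (X k) * (e j).1 * (e i).1) * x k := by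
        intro j
        rw [RingHom.mapMatrix_apply, Matrix.map_apply]
        simp only [M, map_sum, map_mul, eval_C, eval_X]
      simp only [Matrix.mulVec, dotProduct, hM, Pi.zero_apply]
      rw [← h1]
      exact Finset.sum_congr rfl fun k _ => by rw [mul_comm, Finset.mul_sum]
    rw [hac, hc]
    simp

end main

/-- Any artinian Gorenstein algebra with h-vector `(1,5,6,6,5,1)` has the WLP. -/
theorem wlp_156651 {K : Type*} [Field K] [IsAlgClosed K] [CharZero K]
    (I : Ideal (MvPolynomial (Fin 5) K))
    (hAG : IsArtinianGorenstein I 5)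
    (h0 : hf I 0 = 1) (h1 : hf I 1 = 5) (h2 : hf I 2 = 6)
    (h3 : hf I 3 = 6) (h4 : hf I 4 = 5) (h5 : hf I 5 = 1) :
    WLP I := by
  obtain ⟨x, hx⟩ := exists_inj hAG h2
  obtain ⟨p, hp, hpx⟩ := linClass_eq_mk I x
  have hinj : ∀ i, i ≤ 2 → ∀ a ∈ piece I i, linClass I x * a = 0 → a = 0 := by
    intro i hi a ha h
    refine pair_zero hAG (2 - i) i (by omega) ha fun b hb => ?_
    refine hx _ ?_ (by rw [← mul_assoc, h, zero_mul])
    have := piece_mul_mem ha hb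
    rwa [show i + (2 - i) = 2 by omega] at this
  refine ⟨p, hp, fun i => ?_⟩
  rw [hpx]
  by_cases hi : i ≤ 2
  · exact Or.inl (hinj i hi)
  · right
    by_cases hi5 : i < 5
    · exact surj_of_inj hAG (p := 4 - i) (by omega) (linClass_mem I x) (hinj _ (by omega))
    · intro b hb
      have h0 : piece I (i + 1) = ⊥ :=
        Submodule.finrank_eq_zero.1 (hAG.2.2.1 (i + 1) (by omega))
      rw [h0, Submodule.mem_bot] at hb
      exact ⟨0, Submodule.zero_mem _, by rw [hb, mul_zero]⟩
end

section
/- Every artinian Gorenstein algebra A over an algebraically closed field of characteristic zero with socle degree d and Sperner number at most d+1 satisfies the weak Lefschetz property. -/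
open MvPolynomial

theorem aux_ext {K V W : Type*} [Field K] [Infinite K] [AddCommGroup V] [Module K V]
    [FiniteDimensional K V] [AddCommGroup W] [Module K W] (α β : V →ₗ[K] W)
    (hr : ∀ t : K, Module.finrank K (LinearMap.range (α + t • β)) ≤
      Module.finrank K (LinearMap.range α)) (v₀ : V) (hv : α v₀ = 0) :
    ∃ v : ℕ → V, v 0 = v₀ ∧ ∀ i, α (v (i + 1)) = - β (v i) := by
  classical
  obtain ⟨U, hU⟩ := Submodule.exists_isCompl (LinearMap.ker α)
  have hinj : LinearMap.ker (α.comp U.subtype) = ⊥ := by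
    rw [LinearMap.ker_eq_bot']
    intro u hu
    have : (u : V) ∈ LinearMap.ker α ⊓ U := ⟨hu, u.2⟩
    rw [hU.inf_eq_bot] at this
    exact Subtype.ext this
  obtain ⟨γ0, hγ0⟩ := LinearMap.exists_leftInverse_of_injective _ hinj
  set γ : W →ₗ[K] V := U.subtype.comp γ0 with hγ
  have hγU : ∀ w, γ w ∈ U := fun w => (γ0 w).2
  have hγα : ∀ u ∈ U, γ (α u) = u := by
    intro u hu
    have := LinearMap.congr_fun hγ0 ⟨u, hu⟩
    have h2 := congrArg Subtype.val this
    simpa [hγ] using h2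
  have hrk : Module.finrank K (LinearMap.range α) = Module.finrank K U := by
    have h1 := LinearMap.finrank_range_add_finrank_ker α
    have h2 := Submodule.finrank_add_eq_of_isCompl hU
    omega
  set N : V →ₗ[K] V := -(γ.comp β) with hN
  have hNa : ∀ x, N x = - γ (β x) := fun x => rfl
  have hNU : ∀ x, N x ∈ U := fun x => U.neg_mem (hγU _)
  set G : Set K := {t | t ≠ 0 ∧ Function.Injective (LinearMap.id - t • N : V →ₗ[K] V)} with hG
  have hGinf : G.Infinite := by
    have hfin : {μ : K | Module.End.HasEigenvalue (N : Module.End K V) μ}.Finite :=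
      Module.End.finite_hasEigenvalue N
    have h2 : ((fun t : K => t⁻¹) ⁻¹' {μ : K | Module.End.HasEigenvalue (N : Module.End K V) μ}).Finite :=
      hfin.preimage (inv_injective.injOn)
    have h3 := (h2.union (Set.finite_singleton (0 : K))).infinite_compl
    refine h3.mono ?_
    intro t ht
    simp only [Set.mem_compl_iff, Set.mem_union, Set.mem_preimage, Set.mem_ofPred_eq,
      Set.mem_singleton_iff, not_or] at ht
    refine ⟨ht.2, ?_⟩
    rw [injective_iff_map_eq_zero]
    intro x hx
    by_contra hx0
    apply ht.1
    apply Module.End.hasEigenvalue_of_hasEigenvector (x := x)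
    rw [Module.End.hasEigenvector_iff, Module.End.mem_eigenspace_iff]
    refine ⟨?_, hx0⟩
    have hx' : x = t • N x := by
      simpa [sub_eq_zero] using hx
    rw [eq_inv_smul_iff₀ ht.2]
    exact hx'.symm
  have hw : ∀ t ∈ G, ∃ w, w - t • N w = v₀ := by
    intro t ht
    obtain ⟨w, hw⟩ := (LinearMap.injective_iff_surjective.mp ht.2) v₀
    exact ⟨w, by simpa using hw⟩
  choose! w hw using hw
  have hker : ∀ t ∈ G, w t ∈ LinearMap.ker (α.comp N + β) := by
    intro t ht
    have hwt := hw t ht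
    have hww : w t = v₀ + t • N (w t) := by rw [← hwt]; abel
    have hαw : α (w t) = t • α (N (w t)) := by
      conv_lhs => rw [hww]
      simp [hv]
    have hγu : ∀ u ∈ U, γ ((α + t • β) u) = (LinearMap.id - t • N : V →ₗ[K] V) u := by
      intro u hu
      simp [hγα u hu, hNa]
    have hz : γ ((α + t • β) (w t)) = 0 := by
      simp only [LinearMap.add_apply, LinearMap.smul_apply, hαw, map_add, map_smul,
        hγα _ (hNU _)]
      rw [hNa]; simp
    have hUinj : ∀ u ∈ U, (α + t • β) u = 0 → u = 0 := by
      intro u hu h0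
      have := hγu u hu
      rw [h0, map_zero] at this
      exact (injective_iff_map_eq_zero _).mp ht.2 u this.symm
    have hdim : Module.finrank K (U.map (α + t • β)) = Module.finrank K U := by
      have : Function.Injective ((α + t • β).comp U.subtype) := by
        rw [injective_iff_map_eq_zero]
        intro u hu
        exact Subtype.ext (hUinj u u.2 hu)
      have h2 := LinearMap.finrank_range_of_inj this
      rwa [LinearMap.range_comp, Submodule.range_subtype] at h2
    have heq : U.map (α + t • β) = LinearMap.range (α + t • β) := by
      apply Submodule.eq_of_le_of_finrank_le
      · exact LinearMap.map_le_range
      · rw [hdim, ← hrk]; exact hr t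
    have hmem : (α + t • β) (w t) ∈ U.map (α + t • β) := by
      rw [heq]; exact ⟨_, rfl⟩
    obtain ⟨u, hu, hu2⟩ := hmem
    have hu0 : u = 0 := by
      have := hγu u hu
      rw [hu2, hz] at this
      exact (injective_iff_map_eq_zero _).mp ht.2 u this.symm
    rw [hu0, map_zero] at hu2
    have h3 : t • (α.comp N + β) (w t) = 0 := by
      rw [hu2]
      simp [hαw]
    exact (smul_eq_zero.mp h3).resolve_left ht.1
  set D := Submodule.span K (w '' G) with hD
  have hDker : D ≤ LinearMap.ker (α.comp N + β) := by
    rw [hD, Submodule.span_le]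
    rintro _ ⟨t, ht, rfl⟩
    exact hker t ht
  have hv0 : v₀ ∈ D := by
    have hfg : D.FG := IsNoetherian.noetherian D
    obtain ⟨F, hFsub, hFspan⟩ := (Submodule.fg_span_iff_fg_span_finset_subset (w '' G)).mp hfg
    obtain ⟨F', hF'G, rfl⟩ := Finset.subset_set_image_iff.mp hFsub
    obtain ⟨t, htG, htF⟩ := hGinf.exists_notMem_finset F'
    have hle : D ≤ D.map (LinearMap.id - t • N : V →ₗ[K] V) := by
      conv_lhs => rw [hD, hFspan]
      rw [Submodule.span_le]
      intro x hx
      simp only [Finset.coe_image, Set.mem_image, Finset.mem_coe] at hx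
      obtain ⟨s, hs, rfl⟩ := hx
      have hsG : s ∈ G := hF'G hs
      have hst : s ≠ t := fun h => htF (h ▸ hs)
      have hs0 : s ≠ 0 := hsG.1
      have hc : (1 - t / s) ≠ 0 := by
        intro h
        apply hst
        field_simp at h
        linear_combination h
      refine ⟨(1 - t / s)⁻¹ • (w s - (t / s) • w t), ?_, ?_⟩
      · apply D.smul_mem
        apply D.sub_mem (Submodule.subset_span ⟨s, hsG, rfl⟩)
        exact D.smul_mem _ (Submodule.subset_span ⟨t, htG, rfl⟩)
      · rw [map_smul, inv_smul_eq_iff₀ hc]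
        have e1 : t • N (w t) = w t - v₀ := by rw [← hw t htG]; abel
        have e2 : t • N (w s) = (t / s) • (w s - v₀) := by
          have : s • N (w s) = w s - v₀ := by rw [← hw s hsG]; abel
          rw [← this, smul_smul, div_mul_cancel₀ _ hs0]
        simp only [LinearMap.sub_apply, LinearMap.id_apply, LinearMap.smul_apply, map_sub,
          map_smul, smul_sub, e2]
        rw [e1]
        module
    have heq : D = D.map (LinearMap.id - t • N : V →ₗ[K] V) := by
      apply Submodule.eq_of_le_of_finrank_le hle
      exact Submodule.finrank_map_le _ _
    rw [heq]
    exact ⟨w t, Submodule.subset_span ⟨t, htG, rfl⟩, by simpa using hw t htG⟩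
  have hND : ∀ x ∈ D, N x ∈ D := by
    intro x hx
    have : D ≤ D.comap N := by
      conv_lhs => rw [hD]
      rw [Submodule.span_le]
      rintro _ ⟨s, hs, rfl⟩
      have : N (w s) = s⁻¹ • (w s - v₀) := by
        rw [eq_inv_smul_iff₀ hs.1, ← hw s hs]; abel
      change N (w s) ∈ D
      rw [this]
      exact D.smul_mem _ (D.sub_mem (Submodule.subset_span ⟨s, hs, rfl⟩) hv0)
    exact this hx
  refine ⟨fun i => (N ^ i : Module.End K V) v₀, by simp, ?_⟩
  have hmem : ∀ i, (N ^ i : Module.End K V) v₀ ∈ D := by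
    intro i
    induction i with
    | zero => simpa using hv0
    | succ i ih =>
      rw [pow_succ', Module.End.mul_apply]
      exact hND _ ih
  intro i
  have h := hDker (hmem i)
  have h2 : α (N ((N ^ i : Module.End K V) v₀)) + β ((N ^ i : Module.End K V) v₀) = 0 := h
  change α ((N ^ (i+1) : Module.End K V) v₀) = _
  rw [pow_succ', Module.End.mul_apply]
  exact eq_neg_of_add_eq_zero_left h2

theorem aux_tri {K M : Type*} [Field K] [AddCommGroup M] [Module K M] {N : ℕ}
    (v : Fin N → M) (φ : Fin N → M →ₗ[K] K) (h0 : ∀ i j, i < j → φ j (v i) = 0)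
    (h1 : ∀ i, φ i (v i) ≠ 0) : LinearIndependent K v := by
  classical
  rw [Fintype.linearIndependent_iff]
  intro g hg
  by_contra! hne
  obtain ⟨i0, hi0⟩ := hne
  have hS : (Finset.univ.filter fun i => g i ≠ 0).Nonempty := ⟨i0, by simp [hi0]⟩
  set j := (Finset.univ.filter fun i => g i ≠ 0).max' hS with hj
  have hjm := Finset.max'_mem _ hS
  rw [← hj] at hjm
  have hjg : g j ≠ 0 := by simpa using hjm
  have := congrArg (φ j) hg
  rw [map_sum, map_zero, Finset.sum_eq_single j] at this
  · simp [hjg, h1 j] at this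
  · intro b _ hb
    rcases lt_or_gt_of_ne hb with h | h
    · simp [h0 b j h]
    · have : g b = 0 := by
        by_contra hgb
        have := Finset.le_max' _ b (show b ∈ Finset.univ.filter fun i => g i ≠ 0 by simp [hgb])
        rw [← hj] at this
        exact absurd this (not_le.mpr h)
      simp [this]
  · simp

theorem aux_powcoef {K A : Type*} [Field K] [CharZero K] [CommRing A] [Algebra K A]
    (b c f : A) (k : ℕ) (h : ∀ t : K, (b + t • c) ^ (k + 1) * f = 0) : b ^ k * (c * f) = 0 := by
  rw [← Module.forall_dual_apply_eq_zero_iff K]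
  intro lam
  set p : Polynomial K := ∑ j ∈ Finset.range (k + 1 + 1),
    Polynomial.C (lam (c ^ j * b ^ (k + 1 - j) * ((k + 1).choose j : A) * f)) * Polynomial.X ^ j with hp
  have hp0 : p = 0 := by
    apply Polynomial.funext
    intro t
    have := congrArg lam (h t)
    rw [add_comm, add_pow, Finset.sum_mul, map_sum, map_zero] at this
    rw [hp, Polynomial.eval_finsetSum, Polynomial.eval_zero, ← this]
    apply Finset.sum_congr rfl
    intro j _
    simp only [Polynomial.eval_mul, Polynomial.eval_C, Polynomial.eval_pow, Polynomial.eval_X,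
      smul_pow, smul_mul_assoc, map_smul, smul_eq_mul]
    ring
  have h1 := congrArg (fun q => Polynomial.coeff q 1) hp0
  simp only [hp, Polynomial.finsetSum_coeff, Polynomial.coeff_C_mul_X_pow,
    Polynomial.coeff_zero] at h1
  rw [Finset.sum_eq_single 1 (by intro j _ hj; simp [hj.symm]) (by simp)] at h1
  have h2 : c ^ 1 * b ^ (k + 1 - 1) * ((k + 1).choose 1 : A) * f
      = ((k + 1 : ℕ) : K) • (b ^ k * (c * f)) := by
    rw [Algebra.smul_def]
    simp
    ring
  rw [if_pos rfl, h2, map_smul, smul_eq_mul] at h1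
  exact (mul_eq_zero.mp h1).resolve_left (by exact_mod_cast Nat.succ_ne_zero k)

section AbstractWLP
variable {K A : Type*} [Field K] [CharZero K] [CommRing A] [Algebra K A]

theorem aux_pow (P : ℕ → Submodule K A) (d : ℕ)
    (hmul : ∀ i j x y, x ∈ P i → y ∈ P j → x * y ∈ P (i + j))
    (hsoc : ∀ i < d, ∀ f ∈ P i, (∀ c ∈ P 1, c * f = 0) → f = 0) :
    ∀ k i, i + k = d → ∀ f ∈ P i, (∀ b ∈ P 1, b ^ k * f = 0) → f = 0 := by
  intro k
  induction k with
  | zero =>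
    intro i _ f _ h
    simpa using h 0 (Submodule.zero_mem _)
  | succ k ih =>
    intro i hi f hf h
    refine hsoc i (by omega) f hf fun c hc => ?_
    refine ih (1 + i) (by omega) (c * f) (hmul _ _ _ _ hc hf) fun b hb => ?_
    apply aux_powcoef (K := K)
    intro t
    exact h _ (Submodule.add_mem _ hb (Submodule.smul_mem _ _ hc))

/-- Orthogonal subspaces under a pairing which is nondegenerate on one side. -/
theorem aux_orth (P : ℕ → Submodule K A) (lam : A →ₗ[K] K) (i j : ℕ)
    [FiniteDimensional K (P j)]
    (hnd : ∀ f ∈ P i, (∀ g ∈ P j, lam (f * g) = 0) → f = 0)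
    (U T : Submodule K A) (hU : U ≤ P i) (hT : T ≤ P j)
    (hUT : ∀ u ∈ U, ∀ t ∈ T, lam (u * t) = 0) :
    Module.finrank K U + Module.finrank K T ≤ Module.finrank K (P j) := by
  set T' : Submodule K (P j) := T.comap (P j).subtype with hT'
  let B : A →ₗ[K] Module.Dual K (P j) :=
    (LinearMap.lcomp K K (P j).subtype).comp ((LinearMap.mul K A).compr₂ lam)
  have hB : ∀ x (y : P j), B x y = lam (x * y) := fun x y => rfl
  have hmem : ∀ u : U, B u ∈ T'.dualAnnihilator := by
    intro u
    rw [Submodule.mem_dualAnnihilator]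
    intro y hy
    exact hUT u u.2 y hy
  have hinj : Function.Injective (LinearMap.codRestrict T'.dualAnnihilator (B.comp U.subtype) hmem) := by
    rw [injective_iff_map_eq_zero]
    intro u hu
    apply Subtype.ext
    refine hnd u (hU u.2) fun g hg => ?_
    have := congrArg Subtype.val hu
    exact LinearMap.congr_fun this ⟨g, hg⟩
  have h1 := LinearMap.finrank_le_finrank_of_injective hinj
  have h2 := Subspace.finrank_add_finrank_dualAnnihilator_eq T'
  have h3 : Module.finrank K T' = Module.finrank K T :=
    (Submodule.comapSubtypeEquivOfLe hT).finrank_eq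
  omega

theorem aux_main (P : ℕ → Submodule K A) (d : ℕ)
    (hfin : ∀ i, FiniteDimensional K (P i))
    (hmul : ∀ i j x y, x ∈ P i → y ∈ P j → x * y ∈ P (i + j))
    (h1 : (1 : A) ∈ P 0)
    (hd : Module.finrank K (P d) = 1)
    (hz : ∀ i, d < i → ∀ x ∈ P i, x = 0)
    (hsym : ∀ i, i ≤ d → Module.finrank K (P i) = Module.finrank K (P (d - i)))
    (hsoc : ∀ i < d, ∀ f ∈ P i, (∀ c ∈ P 1, c * f = 0) → f = 0)
    (hsp : ∀ i, Module.finrank K (P i) ≤ d + 1) :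
    ∃ a ∈ P 1, ∀ i, (∀ x ∈ P i, a * x = 0 → x = 0) ∨
      (∀ y ∈ P (i + 1), ∃ x ∈ P i, a * x = y) := by
  classical
  have hpow : ∀ k x, x ∈ P 1 → x ^ k ∈ P k := by
    intro k x hx
    induction k with
    | zero => simpa using h1
    | succ k ih => rw [pow_succ]; exact hmul _ _ _ _ ih hx
  have hap := aux_pow P d hmul hsoc
  -- functional
  obtain ⟨lam, hlam⟩ : ∃ lam : A →ₗ[K] K, ∀ x ∈ P d, lam x = 0 → x = 0 := by
    obtain ⟨e, he, hspan⟩ := finrank_eq_one_iff'.mp hd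
    have he' : (e : A) ≠ 0 := fun h => he (Subtype.ext h)
    obtain ⟨lam, hl⟩ : ∃ lam : Module.Dual K A, lam (e : A) ≠ 0 := by
      by_contra! hc
      exact he' ((Module.forall_dual_apply_eq_zero_iff K _).mp hc)
    refine ⟨lam, fun x hx h0 => ?_⟩
    obtain ⟨c, hc⟩ := hspan ⟨x, hx⟩
    have hc' : c • (e : A) = x := congrArg Subtype.val hc
    rw [← hc', map_smul, smul_eq_mul] at h0
    rw [← hc', (mul_eq_zero.mp h0).resolve_right hl, zero_smul]
  have hnd : ∀ i j, i + j = d → ∀ f ∈ P i, (∀ g ∈ P j, lam (f * g) = 0) → f = 0 := by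
    intro i j hij f hf h
    refine hap j i hij f hf fun b hb => ?_
    apply hlam
    · rw [← hij, add_comm]; exact hmul _ _ _ _ (hpow _ _ hb) hf
    · rw [mul_comm]; exact h _ (hpow _ _ hb)
  rcases Nat.eq_zero_or_pos d with hd0 | hdpos
  · refine ⟨0, Submodule.zero_mem _, fun i => Or.inr fun y hy => ⟨0, Submodule.zero_mem _, ?_⟩⟩
    rw [hz (i + 1) (by omega) y hy, mul_zero]
  obtain ⟨q, hq⟩ : ∃ q, d = 2 * q + 1 ∨ d = 2 * q + 2 := ⟨(d - 1) / 2, by omega⟩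
  -- maximal rank
  let Mu : A → (P q →ₗ[K] A) := fun a => (LinearMap.mulLeft K a).comp (P q).subtype
  have hMu : ∀ a (x : P q), Mu a x = a * x := fun a x => rfl
  let S : Set ℕ := {r | ∃ a ∈ P 1, Module.finrank K (LinearMap.range (Mu a)) = r}
  have hSb : BddAbove S := by
    refine ⟨Module.finrank K (P q), ?_⟩
    rintro r ⟨a, _, rfl⟩
    exact LinearMap.finrank_range_le _
  have hSn : S.Nonempty := ⟨_, 0, Submodule.zero_mem _, rfl⟩
  obtain ⟨a, ha, har⟩ := Nat.sSup_mem hSn hSb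
  have hmax : ∀ b ∈ P 1, Module.finrank K (LinearMap.range (Mu b)) ≤
      Module.finrank K (LinearMap.range (Mu a)) := by
    intro b hb
    rw [har]
    exact le_csSup hSb ⟨b, hb, rfl⟩
  -- injectivity in the middle
  have hinj : ∀ x ∈ P q, a * x = 0 → x = 0 := by
    intro x hx hax
    by_contra hx0
    set k := d - q with hk
    obtain ⟨b, hb, hbx⟩ : ∃ b ∈ P 1, b ^ k * x ≠ 0 := by
      by_contra! hc
      exact hx0 (hap k q (by omega) x hx hc)
    obtain ⟨v, hv0, hv⟩ := aux_ext (Mu a) (Mu b) (by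
      intro t
      have : Mu a + t • Mu b = Mu (a + t • b) := by
        ext y
        simp [hMu, add_mul]
      rw [this]
      exact hmax _ (Submodule.add_mem _ ha (Submodule.smul_mem _ _ hb))) ⟨x, hx⟩ hax
    set f : ℕ → A := fun i => (v i : A) with hf
    have hfP : ∀ i, f i ∈ P q := fun i => (v i).2
    have hf0 : f 0 = x := by simp [hf, hv0]
    have haf0 : a * f 0 = 0 := by rw [hf0]; exact hax
    have haf : ∀ i, a * f (i + 1) = - (b * f i) := fun i => hv i
    -- isotropy
    have hiso : ∀ i j, a * f i * f j = 0 := by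
      intro i
      induction i with
      | zero => intro j; rw [haf0, zero_mul]
      | succ i ih =>
        intro j
        have e1 := ih (j + 1)
        linear_combination (f j) * haf i + e1 - (f i) * haf j
    have hisob : ∀ i j, b * f i * f j = 0 := by
      intro i j
      linear_combination (f j) * haf i - hiso (i + 1) j
    -- triangularity
    have hlow : ∀ i, a ^ (i + 1) * f i = 0 := by
      intro i
      induction i with
      | zero => simpa using haf0
      | succ i ih =>
        linear_combination a ^ (i + 1) * haf i - b * ih
    have hdiag : ∀ i, a ^ i * f i = (-1) ^ i * (b ^ i * f 0) := by
      intro i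
      induction i with
      | zero => simp
      | succ i ih =>
        linear_combination a ^ i * haf i - b * ih
    have hlow' : ∀ i j, i < j → a ^ j * f i = 0 := by
      intro i j hij
      obtain ⟨r, rfl⟩ := Nat.exists_eq_add_of_le (Nat.succ_le_of_lt hij)
      rw [Nat.succ_eq_add_one, pow_add]
      linear_combination a ^ r * hlow i
    have hne : ∀ i, i ≤ k → lam (a ^ i * b ^ (k - i) * f i) ≠ 0 := by
      intro i hi h0
      have e : a ^ i * b ^ (k - i) * f i = (-1) ^ i * (b ^ k * x) := by
        have : b ^ k = b ^ i * b ^ (k - i) := by rw [← pow_add]; congr 1; omega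
        rw [this, ← hf0]
        linear_combination b ^ (k - i) * hdiag i
      have hmem : b ^ k * x ∈ P d := by
        have := hmul _ _ _ _ (hpow k b hb) hx
        rwa [show k + q = d by omega] at this
      rw [e] at h0
      apply hbx
      apply hlam _ hmem
      rcases neg_one_pow_eq_or A i with h | h
      · simpa [h] using h0
      · simpa [h] using h0
    have hli1 : LinearIndependent K (fun i : Fin (k + 1) => f i) := by
      apply aux_tri _ (fun j : Fin (k + 1) => lam.comp (LinearMap.mulLeft K (a ^ (j : ℕ) * b ^ (k - j))))
      · intro i j hij
        have : a ^ (j : ℕ) * b ^ (k - j) * f i = 0 := by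
          linear_combination b ^ (k - (j : ℕ)) * hlow' i j hij
        change lam (_ * _) = 0
        rw [this, map_zero]
      · intro i
        exact hne i (by omega)
    have hli2 : LinearIndependent K (fun i : Fin k => b * f i) := by
      apply aux_tri _ (fun j : Fin k => lam.comp (LinearMap.mulLeft K (a ^ (j : ℕ) * b ^ (k - 1 - j))))
      · intro i j hij
        have : a ^ (j : ℕ) * b ^ (k - 1 - j) * (b * f i) = 0 := by
          linear_combination b ^ (k - 1 - (j : ℕ)) * b * hlow' i j hij
        change lam (_ * _) = 0
        rw [this, map_zero]
      · intro i
        have h := hne i (by omega)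
        have e : a ^ (i : ℕ) * b ^ (k - 1 - i) * (b * f i) = a ^ (i : ℕ) * b ^ (k - i) * f i := by
          rw [show k - (i : ℕ) = (k - 1 - i) + 1 by omega, pow_succ]; ring
        change lam (_ * _) ≠ 0
        rw [e]
        exact h
    set U := Submodule.span K (Set.range fun i : Fin (k + 1) => f i) with hU
    set T := Submodule.span K (Set.range fun i : Fin k => b * f i) with hT
    have hUd : Module.finrank K U = k + 1 := by
      rw [hU, finrank_span_eq_card hli1, Fintype.card_fin]
    have hTd : Module.finrank K T = k := by
      rw [hT, finrank_span_eq_card hli2, Fintype.card_fin]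
    have hUP : U ≤ P q := by
      rw [hU, Submodule.span_le]
      rintro _ ⟨i, rfl⟩
      exact hfP i
    have hTP : T ≤ P (q + 1) := by
      rw [hT, Submodule.span_le]
      rintro _ ⟨i, rfl⟩
      rw [add_comm]
      exact hmul _ _ _ _ hb (hfP i)
    have hgen : ∀ (X Y : Set A), (∀ x ∈ X, ∀ y ∈ Y, x * y = 0) →
        ∀ u ∈ Submodule.span K X, ∀ t ∈ Submodule.span K Y, lam (u * t) = 0 := by
      intro X Y h u hu t ht
      have : u * t = 0 := by
        induction hu, ht using Submodule.span_induction₂ with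
        | mem_mem x y hx hy => exact h x hx y hy
        | zero_left => simp
        | zero_right => simp
        | add_left x y z _ _ _ h1 h2 => rw [add_mul, h1, h2, add_zero]
        | add_right x y z _ _ _ h1 h2 => rw [mul_add, h1, h2, add_zero]
        | smul_left r x y _ _ h1 => rw [smul_mul_assoc, h1, smul_zero]
        | smul_right r x y _ _ h1 => rw [mul_smul_comm, h1, smul_zero]
      rw [this, map_zero]
    have hsp1 := hsp (q + 1)
    have := hfin (q + 1)
    rcases hq with hq | hq
    · have := aux_orth P lam q (q + 1) (hnd q (q + 1) (by omega)) U T hUP hTP (by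
        apply hgen
        rintro _ ⟨i, rfl⟩ _ ⟨j, rfl⟩
        linear_combination hisob j i)
      omega
    · have := aux_orth P lam (q + 1) (q + 1) (hnd (q + 1) (q + 1) (by omega)) T T hTP hTP (by
        apply hgen
        rintro _ ⟨i, rfl⟩ _ ⟨j, rfl⟩
        linear_combination b * hisob i j)
      omega
  have hinj' : ∀ i, i ≤ q → ∀ x ∈ P i, a * x = 0 → x = 0 := by
    intro i hi x hx hax
    refine hap (d - i) i (by omega) x hx fun b hb => ?_
    have e := hinj (b ^ (q - i) * x) (by
      have := hmul _ _ _ _ (hpow (q - i) b hb) hx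
      rwa [show q - i + i = q by omega] at this) (by linear_combination b ^ (q - i) * hax)
    rw [show d - i = (d - q) + (q - i) by omega, pow_add, mul_assoc, e, mul_zero]
  refine ⟨a, ha, fun i => ?_⟩
  by_cases hi : i ≤ q
  · exact Or.inl (hinj' i hi)
  right
  by_cases hid : d < i + 1
  · intro y hy
    exact ⟨0, Submodule.zero_mem _, by rw [hz _ hid y hy, mul_zero]⟩
  -- dimension count: the image of `P i` and rank of the transposed map
  have := hfin i
  have := hfin (i + 1)
  set T := (P i).map (LinearMap.mulLeft K a) with hT
  have hTP : T ≤ P (i + 1) := by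
    rintro _ ⟨x, hx, rfl⟩
    rw [add_comm]
    exact hmul _ _ _ _ ha hx
  -- kernel of `a` on `P i`
  set Z : Submodule K A := P i ⊓ LinearMap.ker (LinearMap.mulLeft K a) with hZ
  set U := (P (d - i - 1)).map (LinearMap.mulLeft K a) with hU
  have hUd : Module.finrank K U = Module.finrank K (P (d - i - 1)) := by
    have hin : Function.Injective ((LinearMap.mulLeft K a).comp (P (d - i - 1)).subtype) := by
      rw [injective_iff_map_eq_zero]
      intro x hx
      exact Subtype.ext (hinj' _ (by omega) x x.2 hx)
    have h2 := LinearMap.finrank_range_of_inj hin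
    rwa [LinearMap.range_comp, Submodule.range_subtype] at h2
  have hUP : U ≤ P (d - i) := by
    rintro _ ⟨x, hx, rfl⟩
    rw [show d - i = 1 + (d - i - 1) by omega]
    exact hmul _ _ _ _ ha hx
  have hor := aux_orth P lam (d - i) i (hnd _ _ (by omega)) U Z hUP inf_le_left (by
    rintro _ ⟨x, hx, rfl⟩ z ⟨_, hz2⟩
    have hz3 : a * z = 0 := hz2
    have : (LinearMap.mulLeft K a) x * z = 0 := by
      rw [LinearMap.mulLeft_apply]; linear_combination x * hz3
    rw [this, map_zero])
  have hrn := LinearMap.finrank_range_add_finrank_ker ((LinearMap.mulLeft K a).comp (P i).subtype)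
  rw [LinearMap.range_comp, Submodule.range_subtype, LinearMap.ker_comp] at hrn
  have hZd : Module.finrank K ((LinearMap.ker (LinearMap.mulLeft K a)).comap (P i).subtype) =
      Module.finrank K Z := by
    have := (Submodule.comapSubtypeEquivOfLe (p := Z) (q := P i) inf_le_left).finrank_eq
    rw [← this, hZ, Submodule.comap_inf, Submodule.comap_subtype_self, top_inf_eq]
  have hs := hsym (i + 1) (by omega)
  rw [show d - (i + 1) = d - i - 1 by omega] at hs
  have hTeq : T = P (i + 1) := by
    apply Submodule.eq_of_le_of_finrank_le hTP
    rw [hT]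
    omega
  intro y hy
  rw [← hTeq] at hy
  obtain ⟨x, hx, hxy⟩ := hy
  exact ⟨x, hx, hxy⟩

end AbstractWLP

/-- Main theorem: every artinian Gorenstein algebra of socle degree `d` and Sperner
number at most `d + 1` satisfies the WLP. -/
theorem wlp_of_sperner_le {K : Type*} [Field K] [IsAlgClosed K] [CharZero K]
    {n : ℕ} (d : ℕ) (I : Ideal (MvPolynomial (Fin n) K))
    (hAG : IsArtinianGorenstein I d)
    (hsperner : ∀ i : ℕ, hf I i ≤ d + 1) :
    WLP I := by
  obtain ⟨hI, hd, hz, hsym, -, hsoc⟩ := hAG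
  have hfin : ∀ i, FiniteDimensional K (piece I i) := by
    intro i
    exact Module.Finite.iff_fg.mpr ((homogeneousSubmodule_fg (σ := Fin n) (R := K) i).map _)
  have hmul : ∀ i j x y, x ∈ piece I i → y ∈ piece I j → x * y ∈ piece I (i + j) := by
    rintro i j _ _ ⟨p, hp, rfl⟩ ⟨q, hq, rfl⟩
    exact ⟨p * q, IsHomogeneous.mul hp hq, by simp⟩
  have h1 : (1 : MvPolynomial (Fin n) K ⧸ I) ∈ piece I 0 :=
    ⟨1, isHomogeneous_one _ _, by simp⟩
  have hz' : ∀ i, d < i → ∀ x ∈ piece I i, x = 0 := by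
    intro i hi x hx
    have := hfin i
    have h0 : piece I i = ⊥ := Submodule.finrank_eq_zero.mp (hz i hi)
    rw [h0] at hx
    exact hx
  have hsoc' : ∀ i < d, ∀ f ∈ piece I i, (∀ c ∈ piece I 1, c * f = 0) → f = 0 := by
    intro i hi f hf hc
    have hfd : f ∈ piece I d := by
      apply hsoc
      unfold socle
      rw [Submodule.mem_iInf]
      intro j
      exact hc _ ⟨X j, isHomogeneous_X K j, rfl⟩
    obtain ⟨p, hp, rfl⟩ := hf
    obtain ⟨p', hp', hpp⟩ := hfd
    have hmem : p - p' ∈ I := Ideal.Quotient.eq.mp hpp.symm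
    have h2 := hI _ hmem i
    rw [map_sub, homogeneousComponent_of_mem hp, homogeneousComponent_of_mem hp', if_pos rfl,
      if_neg (by omega), sub_zero] at h2
    exact Ideal.Quotient.eq_zero_iff_mem.mpr h2
  obtain ⟨a, ⟨l, hl, rfl⟩, h⟩ := aux_main (piece I) d hfin hmul h1 hd hz' hsym hsoc' hsperner
  exact ⟨l, hl, h⟩
end
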